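/- arXiv:1905.09159 — 2 statements merged into one kernel-verified Lean document; each statement's English description precedes it below -/
import Mathlib

section
/- (Fractional Gronwall lemma) Let α, μ, ν, T ∈ ℝ₊ with α > 0, and let Δ : [0,T] → ℝ be a continuous function satisfying |Δ(t)| ≤ μ + (ν/Γ(α)) ∫₀ᵗ (t−s)^{α−1} |Δ(s)| ds for all t ∈ [0,T]. Then |Δ(t)| ≤ μ E_α(ν t^α) for all t ∈ [0,T]. -/
open Real MeasureTheory Set

/-- The Mittag-Leffler function `E_α(t) = ∑_{k=0}^∞ t^k / Γ(αk+1)`. -/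
noncomputable def mittagLeffler (α t : ℝ) : ℝ :=
  ∑' k : ℕ, t ^ k / Real.Gamma (α * k + 1)

/-- The terms of the Mittag-Leffler series. -/
noncomputable def mlTerm (α ν : ℝ) (k : ℕ) (s : ℝ) : ℝ :=
  (ν * s ^ α) ^ k / Real.Gamma (α * k + 1)

theorem gamma_lower (R y : ℝ) (hR : 0 < R) (hy : 0 ≤ y) :
    R ^ y * Real.exp (-R) ≤ Real.Gamma (y + 1) := by
  rw [Real.Gamma_eq_integral (by linarith)]
  have hint := Real.GammaIntegral_convergent (s := y + 1) (by linarith)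
  have hsub : Ioi R ⊆ Ioi (0:ℝ) := Ioi_subset_Ioi hR.le
  calc R ^ y * Real.exp (-R) = ∫ x in Ioi R, R ^ y * Real.exp (-x) := by
        rw [integral_const_mul, integral_exp_neg_Ioi]
    _ ≤ ∫ x in Ioi R, Real.exp (-x) * x ^ (y + 1 - 1) := by
        apply setIntegral_mono_on
        · exact (integrableOn_exp_neg_Ioi R).const_mul _
        · exact hint.mono_set hsub
        · exact measurableSet_Ioi
        · intro x hx
          rw [mul_comm, add_sub_cancel_right]
          have : R ^ y ≤ x ^ y := Real.rpow_le_rpow hR.le (le_of_lt hx) hy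
          gcongr
    _ ≤ _ := by
        apply setIntegral_mono_set hint
        · filter_upwards [ae_restrict_mem measurableSet_Ioi] with x hx
          have : (0:ℝ) < x := hx
          simp only [Pi.zero_apply]
          positivity
        · exact hsub.eventuallyLE

theorem ml_summable (α x : ℝ) (hα : 0 < α) (hx : 0 ≤ x) :
    Summable (fun k : ℕ => x ^ k / Real.Gamma (α * k + 1)) := by
  set R : ℝ := (2 * x + 1) ^ α⁻¹ with hR
  have hRpos : 0 < R := by positivity
  have hRα : R ^ α = 2 * x + 1 := Real.rpow_inv_rpow (by positivity) hα.ne'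
  have hg : Summable (fun k : ℕ => Real.exp R * (x / (2 * x + 1)) ^ k) := by
    apply Summable.mul_left
    apply summable_geometric_of_lt_one (by positivity)
    rw [div_lt_one (by positivity)]; linarith
  refine Summable.of_nonneg_of_le (fun k => ?_) (fun k => ?_) hg
  · have : 0 < Real.Gamma (α * k + 1) := Real.Gamma_pos_of_pos (by positivity)
    positivity
  · have h1 := gamma_lower R (α * k) hRpos (by positivity)
    rw [Real.rpow_mul hRpos.le, hRα, Real.rpow_natCast] at h1
    calc x ^ k / Real.Gamma (α * k + 1) ≤ x ^ k / ((2 * x + 1) ^ k * Real.exp (-R)) := by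
          gcongr
      _ = _ := by
          rw [Real.exp_neg, div_pow]; field_simp

theorem beta_real (u v t : ℝ) (hu : 0 < u) (hv : 0 < v) (ht : 0 < t) :
    ∫ s in (0:ℝ)..t, (t - s) ^ (v - 1) * s ^ (u - 1)
      = t ^ (u + v - 1) * (Real.Gamma u * Real.Gamma v / Real.Gamma (u + v)) := by
  have h := Complex.betaIntegral_scaled (u:ℂ) (v:ℂ) ht
  rw [Complex.betaIntegral_eq_Gamma_mul_div _ _ (by simpa) (by simpa)] at h
  apply Complex.ofReal_injective
  rw [← intervalIntegral.integral_ofReal]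
  push_cast [Complex.ofReal_cpow ht.le, ← Complex.Gamma_ofReal]
  rw [← h]
  apply intervalIntegral.integral_congr
  intro s hs
  rw [uIcc_of_le ht.le] at hs
  simp only
  rw [Complex.ofReal_cpow (by linarith [hs.2]), Complex.ofReal_cpow hs.1]
  push_cast
  ring

theorem ml_step (α ν t : ℝ) (k : ℕ) (hα : 0 < α) (ht : 0 ≤ t) :
    ν / Real.Gamma α * ∫ s in (0:ℝ)..t, (t - s) ^ (α - 1) * mlTerm α ν k s
      = mlTerm α ν (k + 1) t := by
  rcases ht.eq_or_lt with rfl | ht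
  · simp [mlTerm, Real.zero_rpow hα.ne']
  have hk : 0 < α * k + 1 := by positivity
  have h1 : ∫ s in (0:ℝ)..t, (t - s) ^ (α - 1) * mlTerm α ν k s
      = ν ^ k / Real.Gamma (α * k + 1) *
        ∫ s in (0:ℝ)..t, (t - s) ^ (α - 1) * s ^ (α * k + 1 - 1) := by
    rw [← intervalIntegral.integral_const_mul]
    apply intervalIntegral.integral_congr
    intro s hs
    rw [uIcc_of_le ht.le] at hs
    simp only [mlTerm]
    rw [add_sub_cancel_right, Real.rpow_mul hs.1, Real.rpow_natCast, mul_pow]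
    ring
  rw [h1, beta_real _ _ _ hk hα ht, mlTerm, mul_pow, ← Real.rpow_natCast (t ^ α),
    ← Real.rpow_mul ht.le]
  have e1 : α * k + 1 + α = α * ((k + 1 : ℕ) : ℝ) + 1 := by push_cast; ring
  rw [e1, add_sub_cancel_right]
  have := (Real.Gamma_pos_of_pos hα).ne'
  have := (Real.Gamma_pos_of_pos hk).ne'
  field_simp
  ring

theorem kernel_int (α t : ℝ) (hα : 0 < α) (ht : 0 ≤ t) (g : ℝ → ℝ)
    (hg : ContinuousOn g (Icc 0 t)) :
    IntervalIntegrable (fun s => (t - s) ^ (α - 1) * g s) volume 0 t := by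
  apply IntervalIntegrable.mul_continuousOn
  · have := (intervalIntegral.intervalIntegrable_rpow' (a := t) (b := 0) (r := α - 1)
      (by linarith)).comp_sub_left t
    simpa using this
  · rwa [uIcc_of_le ht]

theorem mlTerm_cont (α ν : ℝ) (k : ℕ) (hα : 0 < α) : Continuous (mlTerm α ν k) := by
  unfold mlTerm
  have := Real.continuous_rpow_const hα.le
  fun_prop

/-- Fractional Gronwall lemma. -/
theorem stmt3 (α μ ν T : ℝ) (hα : 0 < α) (hμ : 0 ≤ μ) (hν : 0 ≤ ν) (hT : 0 ≤ T)
    (Δ : ℝ → ℝ) (hΔ : ContinuousOn Δ (Set.Icc 0 T))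
    (h : ∀ t ∈ Set.Icc (0:ℝ) T,
      |Δ t| ≤ μ + (ν / Real.Gamma α) *
        ∫ s in (0:ℝ)..t, ((t - s) ^ (α - 1)) * |Δ s|) :
    ∀ t ∈ Set.Icc (0:ℝ) T, |Δ t| ≤ μ * mittagLeffler α (ν * t ^ α) := by
  obtain ⟨M, hM⟩ := isCompact_Icc.exists_bound_of_continuousOn hΔ
  have hG := Real.Gamma_pos_of_pos hα
  have key : ∀ n : ℕ, ∀ t ∈ Set.Icc (0:ℝ) T,
      |Δ t| ≤ μ * ∑ k ∈ Finset.range n, mlTerm α ν k t + M * mlTerm α ν n t := by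
    intro n
    induction n with
    | zero =>
      intro t ht
      simpa [mlTerm] using hM t ht
    | succ n ih =>
      intro t ht
      have hc := fun k => mlTerm_cont α ν k hα
      have hi : ∀ k, IntervalIntegrable (fun s => (t - s) ^ (α - 1) * mlTerm α ν k s)
          volume 0 t := fun k => kernel_int α t hα ht.1 _ (hc k).continuousOn
      have hmono : ∫ s in (0:ℝ)..t, ((t - s) ^ (α - 1)) * |Δ s| ≤
          ∫ s in (0:ℝ)..t, (t - s) ^ (α - 1) *
            (μ * ∑ k ∈ Finset.range n, mlTerm α ν k s + M * mlTerm α ν n s) := by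
        apply intervalIntegral.integral_mono_on ht.1
        · exact kernel_int α t hα ht.1 _ (hΔ.mono (Icc_subset_Icc_right ht.2)).abs
        · apply kernel_int α t hα ht.1
          apply Continuous.continuousOn
          fun_prop
        · intro s hs
          have h0 : 0 ≤ t - s := by linarith [hs.2]
          exact mul_le_mul_of_nonneg_left (ih s ⟨hs.1, hs.2.trans ht.2⟩)
            (Real.rpow_nonneg h0 _)
      have heq : ∫ s in (0:ℝ)..t, (t - s) ^ (α - 1) *
            (μ * ∑ k ∈ Finset.range n, mlTerm α ν k s + M * mlTerm α ν n s)
          = μ * ∑ k ∈ Finset.range n, (∫ s in (0:ℝ)..t, (t - s) ^ (α - 1) * mlTerm α ν k s)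
            + M * ∫ s in (0:ℝ)..t, (t - s) ^ (α - 1) * mlTerm α ν n s := by
        rw [← intervalIntegral.integral_finsetSum (fun k _ => hi k),
          ← intervalIntegral.integral_const_mul, ← intervalIntegral.integral_const_mul,
          ← intervalIntegral.integral_add]
        · congr 1
          ext s
          rw [← Finset.mul_sum]
          ring
        · refine IntervalIntegrable.const_mul ?_ μ
          simp_rw [← Finset.mul_sum]
          apply kernel_int α t hα ht.1
          apply Continuous.continuousOn
          fun_prop
        · exact (hi n).const_mul M
      have h2 := h t ht
      have h3 := mul_le_mul_of_nonneg_left hmono (div_nonneg hν hG.le)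
      rw [heq] at h3
      have h4 : ν / Real.Gamma α * (μ * ∑ k ∈ Finset.range n,
            (∫ s in (0:ℝ)..t, (t - s) ^ (α - 1) * mlTerm α ν k s)
            + M * ∫ s in (0:ℝ)..t, (t - s) ^ (α - 1) * mlTerm α ν n s)
          = μ * ∑ k ∈ Finset.range n, mlTerm α ν (k + 1) t + M * mlTerm α ν (n + 1) t := by
        rw [← ml_step α ν t n hα ht.1,
          ← Finset.sum_congr rfl (fun k _ => ml_step α ν t k hα ht.1), ← Finset.mul_sum]
        ring
      rw [h4] at h3
      rw [Finset.sum_range_succ']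
      have h5 : mlTerm α ν 0 t = 1 := by simp [mlTerm]
      rw [h5]
      linarith
  intro t ht
  have hs := ml_summable α (ν * t ^ α) hα (mul_nonneg hν (Real.rpow_nonneg ht.1 _))
  have hlim := (hs.hasSum.tendsto_sum_nat.const_mul μ).add (hs.tendsto_atTop_zero.const_mul M)
  rw [mul_zero, add_zero] at hlim
  exact ge_of_tendsto' hlim (fun n => key n t ht)
end

section
/- Let α ∈ (0,1), let g : ℝ^d → ℝ^d satisfy a global Lipschitz condition with constant L > 0, and let τ ≥ 0. For f ∈ 𝔠, define (T_τ f)(θ) = f(τ + θ) + (1/Γ(α)) ∫₀^τ (τ + θ − s)^{α−1} g(x_f(s)) ds for θ ≥ 0, where x_f is the unique continuous global solution of x_f(t) = f(t) + (1/Γ(α)) ∫₀ᵗ (t−s)^{α−1} g(x_f(s)) ds. Then T_τ : 𝔠 → 𝔠 is continuous with respect to the metric ρ of uniform convergence on compact subsets. -/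
open Real MeasureTheory Set

/-- `sup_{t∈[0,n]} ‖f(t) − h(t)‖`. -/
noncomputable def supDist {d : ℕ} (n : ℝ)
    (f h : ℝ → EuclideanSpace ℝ (Fin d)) : ℝ :=
  ⨆ t : Set.Icc (0:ℝ) n, ‖f t.1 - h t.1‖

/-- `ρ_n(f,h) = sup_{t∈[0,n]}‖f(t)−h(t)‖ / (1 + sup_{t∈[0,n]}‖f(t)−h(t)‖)`. -/
noncomputable def rhoN {d : ℕ} (n : ℝ)
    (f h : ℝ → EuclideanSpace ℝ (Fin d)) : ℝ :=
  supDist n f h / (1 + supDist n f h)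

/-- The metric `ρ(f,h) = ∑_{n=1}^∞ 2^{−n} ρ_n(f,h)` of uniform convergence on
compact subsets of `ℝ₊`. -/
noncomputable def rhoMetric {d : ℕ}
    (f h : ℝ → EuclideanSpace ℝ (Fin d)) : ℝ :=
  ∑' n : ℕ, (1 / 2 ^ (n + 1)) * rhoN ((n : ℝ) + 1) f h

/-- The operator `(T_τ f)(θ) = f(τ+θ) + (1/Γ(α)) ∫₀^τ (τ+θ−s)^{α−1} g(x_f(s)) ds`,
where `sol f = x_f` is the solution operator. -/
noncomputable def semigroupOp {d : ℕ} (α : ℝ)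
    (g : EuclideanSpace ℝ (Fin d) → EuclideanSpace ℝ (Fin d))
    (sol : (ℝ → EuclideanSpace ℝ (Fin d)) → ℝ → EuclideanSpace ℝ (Fin d))
    (τ : ℝ) (f : ℝ → EuclideanSpace ℝ (Fin d)) :
    ℝ → EuclideanSpace ℝ (Fin d) :=
  fun θ => f (τ + θ) + (1 / Real.Gamma α) •
    ∫ s in (0:ℝ)..τ, ((τ + θ - s) ^ (α - 1)) • g (sol f s)

lemma kernel_ii (α : ℝ) (hα : 0 < α) (c a b : ℝ) :
    IntervalIntegrable (fun s : ℝ => (c - s) ^ (α - 1)) volume a b := by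
  have h := (intervalIntegral.intervalIntegrable_rpow' (a := c - a) (b := c - b)
    (r := α - 1) (by linarith)).comp_sub_left c
  simpa using h

lemma kernel_exp_bound (α : ℝ) (hα : 0 < α) (r : ℝ) (hr : 0 < r) (t : ℝ) (ht : 0 ≤ t) :
    ∫ s in (0:ℝ)..t, (t - s) ^ (α - 1) * Real.exp (-(r * (t - s)))
      ≤ (1 / r) ^ α * Real.Gamma α := by
  rw [intervalIntegral.integral_comp_sub_left
    (fun u : ℝ => u ^ (α - 1) * Real.exp (-(r * u))) t,
    ← Real.integral_rpow_mul_exp_neg_mul_Ioi hα hr, sub_self, sub_zero,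
    intervalIntegral.integral_of_le ht]
  refine setIntegral_mono_set ?_ ?_ ?_
  · have := integrableOn_rpow_mul_exp_neg_mul_rpow (p := 1) (s := α - 1) (b := r)
      (by linarith) one_pos hr
    simpa [Real.rpow_one] using this
  · rw [Filter.EventuallyLE, ae_restrict_iff' measurableSet_Ioi]
    refine Filter.Eventually.of_forall fun u (hu : 0 < u) => ?_
    simp only [Pi.zero_apply]
    positivity
  · exact Ioc_subset_Ioi_self.eventuallyLE

/-- Weakly singular Gronwall inequality. -/
lemma singular_gronwall (α : ℝ) (hα : 0 < α) (L : ℝ) (hL : 0 < L) (τ : ℝ) (hτ : 0 ≤ τ)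
    (w : ℝ → ℝ) (hw : ContinuousOn w (Icc 0 τ)) (hw0 : ∀ t, 0 ≤ w t) (D : ℝ) (hD : 0 ≤ D)
    (H : ∀ t ∈ Icc 0 τ, w t ≤ D + (1 / Real.Gamma α) *
      ∫ s in (0:ℝ)..t, (t - s) ^ (α - 1) * (L * w s)) :
    ∀ t ∈ Icc 0 τ, w t ≤ 2 * Real.exp ((2 * L) ^ (1 / α) * τ) * D := by
  set r : ℝ := (2 * L) ^ (1 / α) with hr_def
  have hr : 0 < r := by positivity
  have hrα : (1 / r) ^ α = 1 / (2 * L) := by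
    rw [Real.div_rpow zero_le_one hr.le, Real.one_rpow, hr_def, ← Real.rpow_mul (by positivity),
      one_div_mul_cancel hα.ne', Real.rpow_one]
  have hG : 0 < Real.Gamma α := Real.Gamma_pos_of_pos hα
  have hc : ContinuousOn (fun t => Real.exp (-(r * t)) * w t) (Icc 0 τ) :=
    (by fun_prop : Continuous fun t : ℝ => Real.exp (-(r * t))).continuousOn.mul hw
  obtain ⟨t₀, ht₀, hmax⟩ := isCompact_Icc.exists_isMaxOn ⟨0, left_mem_Icc.2 hτ⟩ hc
  set M : ℝ := Real.exp (-(r * t₀)) * w t₀ with hM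
  have hM0 : 0 ≤ M := mul_nonneg (Real.exp_pos _).le (hw0 _)
  have hwM : ∀ s ∈ Icc 0 τ, w s ≤ Real.exp (r * s) * M := by
    intro s hs
    have h1 : Real.exp (-(r * s)) * w s ≤ M := hmax hs
    calc w s = Real.exp (r * s) * (Real.exp (-(r * s)) * w s) := by
          rw [← mul_assoc, ← Real.exp_add]; simp
      _ ≤ _ := by gcongr
  have hM2 : M ≤ 2 * D := by
    have h1 := H t₀ ht₀
    have hsub : Icc 0 t₀ ⊆ Icc 0 τ := Icc_subset_Icc_right ht₀.2
    have hk := kernel_ii α hα t₀ 0 t₀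
    have h2 : ∫ s in (0:ℝ)..t₀, (t₀ - s) ^ (α - 1) * (L * w s) ≤
        ∫ s in (0:ℝ)..t₀, (L * M * Real.exp (r * t₀)) *
          ((t₀ - s) ^ (α - 1) * Real.exp (-(r * (t₀ - s)))) := by
      apply intervalIntegral.integral_mono_on ht₀.1
      · refine hk.mul_continuousOn ?_
        rw [uIcc_of_le ht₀.1]
        exact continuousOn_const.mul (hw.mono hsub)
      · exact (hk.mul_continuousOn (by fun_prop)).const_mul _
      · intro s hs
        have h3 := hwM s (hsub hs)
        have h4 : Real.exp (r * s) = Real.exp (r * t₀) * Real.exp (-(r * (t₀ - s))) := by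
          rw [← Real.exp_add]; ring_nf
        have h5 : 0 ≤ (t₀ - s) ^ (α - 1) := Real.rpow_nonneg (by linarith [hs.2]) _
        calc (t₀ - s) ^ (α - 1) * (L * w s)
            ≤ (t₀ - s) ^ (α - 1) * (L * (Real.exp (r * s) * M)) := by gcongr
          _ = _ := by rw [h4]; ring
    rw [intervalIntegral.integral_const_mul] at h2
    have h3 := kernel_exp_bound α hα r hr t₀ ht₀.1
    rw [hrα] at h3
    have h4 : w t₀ ≤ D + (1 / Real.Gamma α) *
        ((L * M * Real.exp (r * t₀)) * (1 / (2 * L) * Real.Gamma α)) := by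
      refine h1.trans ?_
      gcongr
      refine h2.trans ?_
      gcongr
    have h5 : (1 / Real.Gamma α) *
        ((L * M * Real.exp (r * t₀)) * (1 / (2 * L) * Real.Gamma α))
        = M * Real.exp (r * t₀) / 2 := by
      field_simp
    rw [h5] at h4
    have h6 : M ≤ Real.exp (-(r * t₀)) * (D + M * Real.exp (r * t₀) / 2) := by
      rw [hM]; gcongr
    have h7 : Real.exp (-(r * t₀)) * (D + M * Real.exp (r * t₀) / 2)
        = Real.exp (-(r * t₀)) * D + M / 2 := by
      have : Real.exp (-(r * t₀)) * Real.exp (r * t₀) = 1 := by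
        rw [← Real.exp_add]; simp
      linear_combination (M / 2) * this
    have h8 : Real.exp (-(r * t₀)) ≤ 1 := by
      rw [Real.exp_le_one_iff]
      have := mul_nonneg hr.le ht₀.1
      linarith
    have h9 : Real.exp (-(r * t₀)) * D ≤ D := mul_le_of_le_one_left hD h8
    linarith
  intro t ht
  calc w t ≤ Real.exp (r * t) * M := hwM t ht
    _ ≤ Real.exp (r * τ) * (2 * D) := by
      have := ht.2
      gcongr
    _ = _ := by ring

section Metric

variable {d : ℕ}

lemma supDist_nonneg (n : ℝ) (f h : ℝ → EuclideanSpace ℝ (Fin d)) : 0 ≤ supDist n f h :=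
  Real.iSup_nonneg fun _ => norm_nonneg _

lemma norm_le_supDist {n : ℝ} {f h : ℝ → EuclideanSpace ℝ (Fin d)}
    (hf : ContinuousOn f (Ici 0)) (hh : ContinuousOn h (Ici 0)) {t : ℝ} (ht : t ∈ Icc 0 n) :
    ‖f t - h t‖ ≤ supDist n f h := by
  have hc : ContinuousOn (fun t => ‖f t - h t‖) (Icc 0 n) :=
    ((hf.sub hh).norm).mono Icc_subset_Ici_self
  obtain ⟨B, hB⟩ := (isCompact_Icc.image_of_continuousOn hc).bddAbove
  refine le_ciSup (f := fun t : Icc (0:ℝ) n => ‖f t.1 - h t.1‖) ⟨B, ?_⟩ ⟨t, ht⟩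
  rintro _ ⟨s, rfl⟩
  exact hB ⟨s.1, s.2, rfl⟩

lemma rhoN_nonneg (n : ℝ) (f h : ℝ → EuclideanSpace ℝ (Fin d)) : 0 ≤ rhoN n f h := by
  have := supDist_nonneg n f h
  unfold rhoN; positivity

lemma rhoN_le_one (n : ℝ) (f h : ℝ → EuclideanSpace ℝ (Fin d)) : rhoN n f h ≤ 1 := by
  have := supDist_nonneg n f h
  unfold rhoN
  rw [div_le_one (by positivity)]
  linarith

lemma rho_summable (f h : ℝ → EuclideanSpace ℝ (Fin d)) :
    Summable fun n : ℕ => (1 / 2 ^ (n + 1) : ℝ) * rhoN ((n : ℝ) + 1) f h := by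
  refine Summable.of_nonneg_of_le (fun n => mul_nonneg (by positivity) (rhoN_nonneg _ _ _))
    (fun n => ?_) (summable_geometric_two' 1)
  have h1 := rhoN_le_one ((n : ℝ) + 1) f h
  calc (1 / 2 ^ (n + 1) : ℝ) * rhoN ((n : ℝ) + 1) f h ≤ (1 / 2 ^ (n + 1) : ℝ) * 1 := by gcongr
    _ = 1 / 2 / 2 ^ n := by rw [pow_succ]; field_simp

lemma rhoMetric_le (m : ℕ) (K : ℝ) (hK : 1 ≤ K) (f h F H : ℝ → EuclideanSpace ℝ (Fin d))
    (hs : ∀ n : ℕ, supDist ((n : ℝ) + 1) F H ≤ K * supDist (((n + m : ℕ) : ℝ) + 1) f h) :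
    rhoMetric F H ≤ K * 2 ^ m * rhoMetric f h := by
  have hsum := rho_summable f h
  have hshift := (summable_nat_add_iff m).2 hsum
  have hterm : ∀ n : ℕ, (1 / 2 ^ (n + 1) : ℝ) * rhoN ((n : ℝ) + 1) F H ≤
      K * 2 ^ m * ((1 / 2 ^ (n + m + 1) : ℝ) * rhoN (((n + m : ℕ) : ℝ) + 1) f h) := by
    intro n
    have h0 := supDist_nonneg ((n : ℝ) + 1) F H
    have h1 := supDist_nonneg (((n + m : ℕ) : ℝ) + 1) f h
    have h2 : rhoN ((n : ℝ) + 1) F H ≤ K * rhoN (((n + m : ℕ) : ℝ) + 1) f h := by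
      have h3 := hs n
      unfold rhoN
      generalize supDist ((n : ℝ) + 1) F H = a at *
      generalize supDist (((n + m : ℕ) : ℝ) + 1) f h = b at *
      rw [← mul_div_assoc, div_le_div_iff₀ (by positivity) (by positivity)]
      have h5 : a * b ≤ K * b * a := by
        nlinarith [mul_nonneg h0 h1]
      nlinarith
    calc (1 / 2 ^ (n + 1) : ℝ) * rhoN ((n : ℝ) + 1) F H
        ≤ (1 / 2 ^ (n + 1) : ℝ) * (K * rhoN (((n + m : ℕ) : ℝ) + 1) f h) := by gcongr
      _ = _ := by
        rw [show n + m + 1 = (n + 1) + m by ring, pow_add (2:ℝ) (n+1) m]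
        field_simp
  have h4 := hsum.sum_add_tsum_nat_add m
  have h5 : 0 ≤ ∑ i ∈ Finset.range m, (1 / 2 ^ (i + 1) : ℝ) * rhoN ((i : ℝ) + 1) f h :=
    Finset.sum_nonneg fun i _ => mul_nonneg (by positivity) (rhoN_nonneg _ _ _)
  calc rhoMetric F H
      ≤ ∑' n : ℕ, K * 2 ^ m * ((1 / 2 ^ (n + m + 1) : ℝ) * rhoN (((n + m : ℕ) : ℝ) + 1) f h) :=
        (rho_summable F H).tsum_le_tsum hterm (hshift.mul_left _)
    _ = K * 2 ^ m * ∑' n : ℕ, ((1 / 2 ^ (n + m + 1) : ℝ) * rhoN (((n + m : ℕ) : ℝ) + 1) f h) :=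
        tsum_mul_left
    _ ≤ K * 2 ^ m * rhoMetric f h := by
        gcongr
        unfold rhoMetric
        linarith

end Metric

lemma kernel_diff_bound {d : ℕ} (α : ℝ) (hα : 0 < α) (L : ℝ)
    (g : EuclideanSpace ℝ (Fin d) → EuclideanSpace ℝ (Fin d))
    (hg : ∀ x y : EuclideanSpace ℝ (Fin d), ‖g x - g y‖ ≤ L * ‖x - y‖)
    (hgc : Continuous g) (c t : ℝ) (ht : 0 ≤ t) (htc : t ≤ c)
    (x y : ℝ → EuclideanSpace ℝ (Fin d))
    (hx : ContinuousOn x (Ici 0)) (hy : ContinuousOn y (Ici 0)) :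
    ‖(1 / Real.Gamma α) • (∫ s in (0:ℝ)..t, ((c - s) ^ (α - 1)) • g (x s)) -
      (1 / Real.Gamma α) • (∫ s in (0:ℝ)..t, ((c - s) ^ (α - 1)) • g (y s))‖ ≤
    (1 / Real.Gamma α) * ∫ s in (0:ℝ)..t, (c - s) ^ (α - 1) * (L * ‖x s - y s‖) := by
  have hG : 0 < Real.Gamma α := Real.Gamma_pos_of_pos hα
  have hk := kernel_ii α hα c 0 t
  have hsub : uIcc 0 t ⊆ Ici 0 := by rw [uIcc_of_le ht]; exact Icc_subset_Ici_self
  have hx' := hx.mono hsub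
  have hy' := hy.mono hsub
  rw [← smul_sub, ← intervalIntegral.integral_sub
    (hk.smul_continuousOn (g := fun s => g (x s)) (hgc.comp_continuousOn hx'))
    (hk.smul_continuousOn (g := fun s => g (y s)) (hgc.comp_continuousOn hy')), norm_smul,
    Real.norm_of_nonneg (by positivity)]
  gcongr
  refine intervalIntegral.norm_integral_le_of_norm_le ht ?_ ?_
  · refine Filter.Eventually.of_forall fun s hs => ?_
    have h5 : 0 ≤ (c - s) ^ (α - 1) := Real.rpow_nonneg (by linarith [hs.2]) _
    rw [← smul_sub, norm_smul, Real.norm_of_nonneg h5]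
    gcongr
    exact hg _ _
  · exact hk.mul_continuousOn (continuousOn_const.mul (hx'.sub hy').norm)

theorem stmt10 {d : ℕ} (α : ℝ) (hα : α ∈ Set.Ioo (0:ℝ) 1)
    (g : EuclideanSpace ℝ (Fin d) → EuclideanSpace ℝ (Fin d))
    (L : ℝ) (hL : 0 < L)
    (hg : ∀ x y : EuclideanSpace ℝ (Fin d), ‖g x - g y‖ ≤ L * ‖x - y‖)
    (τ : ℝ) (hτ : 0 ≤ τ)
    (sol : (ℝ → EuclideanSpace ℝ (Fin d)) → ℝ → EuclideanSpace ℝ (Fin d))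
    (hsol : ∀ f : ℝ → EuclideanSpace ℝ (Fin d), ContinuousOn f (Set.Ici 0) →
      ContinuousOn (sol f) (Set.Ici 0) ∧
      ∀ t : ℝ, 0 ≤ t →
        sol f t = f t + (1 / Real.Gamma α) •
          ∫ s in (0:ℝ)..t, ((t - s) ^ (α - 1)) • g (sol f s)) :
    (∀ f : ℝ → EuclideanSpace ℝ (Fin d), ContinuousOn f (Set.Ici 0) →
      ContinuousOn (semigroupOp α g sol τ f) (Set.Ici 0)) ∧
    (∀ f : ℝ → EuclideanSpace ℝ (Fin d), ContinuousOn f (Set.Ici 0) →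
      ∀ ε : ℝ, 0 < ε → ∃ δ : ℝ, 0 < δ ∧
        ∀ h : ℝ → EuclideanSpace ℝ (Fin d), ContinuousOn h (Set.Ici 0) →
          rhoMetric f h < δ →
          rhoMetric (semigroupOp α g sol τ f) (semigroupOp α g sol τ h) < ε) := by
  obtain ⟨hα0, hα1⟩ := hα
  have hG : 0 < Real.Gamma α := Real.Gamma_pos_of_pos hα0
  have hgc : Continuous g := by
    refine (LipschitzWith.of_dist_le_mul (K := ⟨L, hL.le⟩) fun x y => ?_).continuous
    rw [dist_eq_norm, dist_eq_norm]
    exact hg x y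
  -- comparison of kernels
  have hkle : ∀ θ : ℝ, 0 ≤ θ → ∀ s : ℝ, s < τ →
      (τ + θ - s) ^ (α - 1) ≤ (τ - s) ^ (α - 1) := fun θ hθ s hs =>
    Real.rpow_le_rpow_of_nonpos (by linarith) (by linarith) (by linarith)
  have hne : ∀ᵐ s : ℝ, s ≠ τ := by
    simp [ae_iff]
  have hcontT : ∀ f : ℝ → EuclideanSpace ℝ (Fin d), ContinuousOn f (Set.Ici 0) →
      ContinuousOn (semigroupOp α g sol τ f) (Set.Ici 0) := by
    intro f hf
    obtain ⟨hx, -⟩ := hsol f hf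
    have hsub : uIcc 0 τ ⊆ Ici 0 := by rw [uIcc_of_le hτ]; exact Icc_subset_Ici_self
    have hgx : ContinuousOn (fun s => g (sol f s)) (uIcc 0 τ) :=
      hgc.comp_continuousOn (hx.mono hsub)
    unfold semigroupOp
    suffices hI : ContinuousOn (fun θ => ∫ s in (0:ℝ)..τ,
        ((τ + θ - s) ^ (α - 1)) • g (sol f s)) (Ici 0) by
      refine ContinuousOn.add ?_ (hI.const_smul (1 / Real.Gamma α))
      refine hf.comp (by fun_prop) fun θ (hθ : 0 ≤ θ) => ?_
      exact add_nonneg hτ hθ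
    · intro θ₀ hθ₀
      refine intervalIntegral.continuousWithinAt_of_dominated_interval
        (bound := fun s => (τ - s) ^ (α - 1) * ‖g (sol f s)‖) ?_ ?_ ?_ ?_
      · refine Filter.Eventually.of_forall fun θ => ?_
        exact ((kernel_ii α hα0 (τ + θ) 0 τ).smul_continuousOn hgx).aestronglyMeasurable_restrict_uIoc
      · filter_upwards [self_mem_nhdsWithin] with θ hθ
        filter_upwards [hne] with s hs hs'
        rw [uIoc_of_le hτ] at hs'
        have hlt : s < τ := lt_of_le_of_ne hs'.2 hs
        have hθ' : 0 ≤ θ := hθ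
        rw [norm_smul, Real.norm_of_nonneg (Real.rpow_nonneg (by linarith) _)]
        exact mul_le_mul_of_nonneg_right (hkle θ hθ' s hlt) (norm_nonneg _)
      · exact (kernel_ii α hα0 τ 0 τ).mul_continuousOn hgx.norm
      · filter_upwards [hne] with s hs hs'
        rw [uIoc_of_le hτ] at hs'
        have hlt : s < τ := lt_of_le_of_ne hs'.2 hs
        have hθ' : 0 ≤ θ₀ := hθ₀
        refine ContinuousAt.continuousWithinAt ?_
        have hc : ContinuousAt (fun x : ℝ => (τ + x - s) ^ (α - 1)) θ₀ :=
          ContinuousAt.rpow_const (by fun_prop) (Or.inl (by linarith))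
        exact hc.smul continuousAt_const
  refine ⟨hcontT, fun f hf ε hε => ?_⟩
  set A : ℝ := 2 * Real.exp ((2 * L) ^ (1 / α) * τ) with hA
  have hA0 : 0 < A := by positivity
  set J : ℝ := ∫ s in (0:ℝ)..τ, (τ - s) ^ (α - 1) with hJ
  have hJ0 : 0 ≤ J := by
    refine intervalIntegral.integral_nonneg hτ fun s hs => Real.rpow_nonneg (by linarith [hs.2]) _
  set K : ℝ := 1 + (1 / Real.Gamma α) * (J * (L * A)) with hK
  have hK1 : 1 ≤ K := by
    have : 0 ≤ (1 / Real.Gamma α) * (J * (L * A)) := by positivity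
    linarith
  obtain ⟨m, hm⟩ := exists_nat_ge τ
  have hKm : 0 < K * 2 ^ m := by positivity
  refine ⟨ε / (K * 2 ^ m), by positivity, fun h hh hlt => ?_⟩
  rw [lt_div_iff₀ hKm, mul_comm] at hlt
  refine lt_of_le_of_lt (rhoMetric_le m K hK1 f h _ _ fun n => ?_) hlt
  obtain ⟨hx, hxe⟩ := hsol f hf
  obtain ⟨hy, hye⟩ := hsol h hh
  set D := supDist (((n + m : ℕ) : ℝ) + 1) f h with hD
  have hD0 : 0 ≤ D := supDist_nonneg _ _ _
  have hn0 : (0:ℝ) ≤ n := Nat.cast_nonneg n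
  have hfh : ∀ t : ℝ, 0 ≤ t → t ≤ (n + m : ℝ) + 1 → ‖f t - h t‖ ≤ D := by
    intro t h0 h1
    exact norm_le_supDist hf hh ⟨h0, by push_cast; exact h1⟩
  have hw : ∀ t ∈ Icc 0 τ, ‖sol f t - sol h t‖ ≤ A * D := by
    refine singular_gronwall α hα0 L hL τ hτ (fun t => ‖sol f t - sol h t‖)
      ((hx.sub hy).norm.mono Icc_subset_Ici_self) (fun _ => norm_nonneg _) D hD0 ?_
    intro t ht
    have h1 := kernel_diff_bound α hα0 L g hg hgc t t ht.1 le_rfl _ _ hx hy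
    have h2 := hfh t ht.1 (by linarith [ht.2])
    change ‖sol f t - sol h t‖ ≤ _
    rw [hxe t ht.1, hye t ht.1, add_sub_add_comm]
    exact (norm_add_le _ _).trans (add_le_add h2 h1)
  have : Nonempty (Icc (0:ℝ) ((n:ℝ) + 1)) := ⟨⟨0, le_rfl, by positivity⟩⟩
  refine ciSup_le fun θ => ?_
  obtain ⟨θ, hθ0, hθ1⟩ := θ
  have h1 := kernel_diff_bound α hα0 L g hg hgc (τ + θ) τ hτ (by linarith) _ _ hx hy
  have h2 := hfh (τ + θ) (by linarith) (by linarith)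
  have h3 : ∫ s in (0:ℝ)..τ, (τ + θ - s) ^ (α - 1) * (L * ‖sol f s - sol h s‖) ≤
      ∫ s in (0:ℝ)..τ, (τ - s) ^ (α - 1) * (L * (A * D)) := by
    refine intervalIntegral.integral_mono_on_of_le_Ioo hτ ?_ ?_ ?_
    · refine (kernel_ii α hα0 (τ + θ) 0 τ).mul_continuousOn (continuousOn_const.mul ?_)
      rw [uIcc_of_le hτ]
      exact (hx.sub hy).norm.mono Icc_subset_Ici_self
    · exact (kernel_ii α hα0 τ 0 τ).mul_const _
    · intro s hs
      have h4 := hkle θ hθ0 s hs.2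
      have h5 := hw s ⟨hs.1.le, hs.2.le⟩
      have h6 : 0 ≤ (τ - s) ^ (α - 1) := Real.rpow_nonneg (by linarith [hs.2]) _
      gcongr
  rw [intervalIntegral.integral_mul_const] at h3
  change ‖semigroupOp α g sol τ f θ - semigroupOp α g sol τ h θ‖ ≤ _
  unfold semigroupOp
  rw [add_sub_add_comm]
  calc _ ≤ _ := norm_add_le _ _
    _ ≤ D + (1 / Real.Gamma α) * (J * (L * (A * D))) := by
      refine add_le_add h2 (h1.trans ?_)
      gcongr
    _ = K * D := by rw [hK]; ring
end
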